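/- Let q be a prime power, n ≥ 1, l ≥ 0, and 1 ≤ m ≤ n; fix an l-dimensional subspace W of 𝔽_q^{n+l}, and let X be the set of m-dimensional subspaces V of 𝔽_q^{n+l} with V ∩ W = 0. Define ℛ(V,V') = (i,j) if dim((V+W)/W ∩ (V'+W)/W) = m−i and dim(V ∩ V') = (m−i)−j, and let D = {(i,j) : 0 ≤ i ≤ min{m, n−m}, 0 ≤ j ≤ min{m−i, l}}. Then the association scheme 𝔛 = (X, ℛ) obtained from this attenuated space is a bivariate P-polynomial association scheme on D with respect to the graded lexicographic order ≤_grlex (for all such parameters, including the case l < m). -/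

import Mathlib

open scoped BigOperators
open Matrix

noncomputable section

/-- The all-ones matrix `J`. -/
def matJ (X : Type*) : Matrix X X ℂ := Matrix.of fun _ _ => 1

/-- A family of matrices `A : ι → Matrix X X ℂ` forms a commutative association scheme:
0-1 matrices summing to `J`, containing the identity, closed under transpose, whose
pairwise products are linear combinations of the family and commute. -/
structure IsAssocScheme {X ι : Type*} [Fintype X] [DecidableEq X] [Fintype ι]
    (A : ι → Matrix X X ℂ) : Prop where
  entries_zero_one : ∀ (i : ι) (x y : X), A i x y = 0 ∨ A i x y = 1
  sum_eq_J : ∑ i, A i = matJ X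
  exists_id : ∃ i₀, A i₀ = 1
  exists_transpose : ∀ i, ∃ i', (A i)ᵀ = A i'
  mul_eq_lin : ∀ i j, ∃ p : ι → ℂ, A i * A j = ∑ k, p k • A k
  mul_comm' : ∀ i j, A i * A j = A j * A i

/-- A monomial order on `ℕ^ℓ`: a total well-ordering compatible with addition. -/
structure MonOrder (ℓ : ℕ) where
  le : (Fin ℓ → ℕ) → (Fin ℓ → ℕ) → Prop
  le_refl : ∀ a, le a a
  le_trans : ∀ a b c, le a b → le b c → le a c
  le_antisymm : ∀ a b, le a b → le b a → a = b
  le_total : ∀ a b, le a b ∨ le b a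
  wf : WellFounded fun a b => le a b ∧ a ≠ b
  add_compat : ∀ a b c, le a b → le (a + c) (b + c)

/-- The `i`-th standard unit vector of `ℕ^ℓ`. -/
def epsV {ℓ : ℕ} (i : Fin ℓ) : Fin ℓ → ℕ := Pi.single i 1

/-- Conversion from `Fin ℓ → ℕ` to exponents of `MvPolynomial`. -/
def toExp {ℓ : ℕ} (α : Fin ℓ → ℕ) : Fin ℓ →₀ ℕ := Finsupp.equivFunOnFinite.symm α

/-- `α` is the multidegree of `f` with respect to the monomial order `mo`. -/
def IsMultideg {ℓ : ℕ} (mo : MonOrder ℓ) (f : MvPolynomial (Fin ℓ) ℂ) (α : Fin ℓ → ℕ) : Prop :=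
  MvPolynomial.coeff (toExp α) f ≠ 0 ∧ ∀ d ∈ f.support, mo.le (⇑d) α

/-- The ordered monomial `M 1 ^ α 1 * ⋯ * M ℓ ^ α ℓ`. -/
def mpow {X : Type*} [Fintype X] [DecidableEq X] {ℓ : ℕ}
    (M : Fin ℓ → Matrix X X ℂ) (α : Fin ℓ → ℕ) : Matrix X X ℂ :=
  ((List.finRange ℓ).map fun i => M i ^ α i).prod

/-- Evaluation of a multivariate polynomial at a family of matrices. -/
def matEval {X : Type*} [Fintype X] [DecidableEq X] {ℓ : ℕ}
    (f : MvPolynomial (Fin ℓ) ℂ) (M : Fin ℓ → Matrix X X ℂ) : Matrix X X ℂ :=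
  ∑ d ∈ f.support, MvPolynomial.coeff d f • mpow M (⇑d)

/-- `ℓ`-variate `P`-polynomial association scheme on the domain `D` with respect to the
monomial order `mo`, with adjacency matrices (relabeled) `A α` for `α ∈ D`. -/
structure IsMultiPPoly {X : Type*} [Fintype X] [DecidableEq X] {ℓ : ℕ}
    (D : Finset (Fin ℓ → ℕ)) (mo : MonOrder ℓ)
    (A : (Fin ℓ → ℕ) → Matrix X X ℂ) : Prop where
  scheme : IsAssocScheme fun α : {a // a ∈ D} => A α.1
  eps_mem : ∀ i : Fin ℓ, epsV i ∈ D
  lower_closed : ∀ α ∈ D, ∀ β : Fin ℓ → ℕ, (∀ i, β i ≤ α i) → β ∈ D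
  exists_poly : ∀ α ∈ D, ∃ v : MvPolynomial (Fin ℓ) ℂ,
    A α = matEval v (fun i => A (epsV i)) ∧ IsMultideg mo v α ∧
      ∀ d ∈ v.support, ⇑d ∈ D
  recur : ∀ i : Fin ℓ, ∀ α ∈ D, ∃ c : (Fin ℓ → ℕ) → ℂ,
    (A (epsV i) * mpow (fun j => A (epsV j)) α
        = ∑ β ∈ D, c β • mpow (fun j => A (epsV j)) β) ∧
      ∀ β ∈ D, c β ≠ 0 → mo.le β (α + epsV i)

/-- The Hadamard (entrywise) monomial `E 1 ^{∘ α 1} ∘ ⋯ ∘ E ℓ ^{∘ α ℓ}`. -/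
def hpow {X : Type*} {ℓ : ℕ} (E : Fin ℓ → Matrix X X ℂ) (α : Fin ℓ → ℕ) : Matrix X X ℂ :=
  Matrix.of fun x y => ∏ i, (E i x y) ^ α i

/-- Evaluation of a multivariate polynomial at a family of matrices under the
Hadamard product. -/
def hEval {X : Type*} {ℓ : ℕ}
    (f : MvPolynomial (Fin ℓ) ℂ) (E : Fin ℓ → Matrix X X ℂ) : Matrix X X ℂ :=
  ∑ d ∈ f.support, MvPolynomial.coeff d f • hpow E (⇑d)

/-- `E` is the family of primitive idempotents of the Bose–Mesner algebra spanned by `A`. -/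
structure IsPrimIdem {X ι κ : Type*} [Fintype X] [DecidableEq X] [Fintype ι] [Fintype κ]
    (A : ι → Matrix X X ℂ) (E : κ → Matrix X X ℂ) : Prop where
  idem : ∀ j, E j * E j = E j
  orth : ∀ j k, j ≠ k → E j * E k = 0
  sum_eq_one : ∑ j, E j = 1
  span_eq : Submodule.span ℂ (Set.range E) = Submodule.span ℂ (Set.range A)

/-- `ℓ`-variate `Q`-polynomial association scheme on the domain `D` with respect to the
monomial order `mo`; `A` are the adjacency matrices and `E α` for `α ∈ D` the (relabeled)
primitive idempotents. -/
structure IsMultiQPoly {X ι : Type*} [Fintype X] [DecidableEq X] [Fintype ι] {ℓ : ℕ}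
    (D : Finset (Fin ℓ → ℕ)) (mo : MonOrder ℓ)
    (A : ι → Matrix X X ℂ) (E : (Fin ℓ → ℕ) → Matrix X X ℂ) : Prop where
  scheme : IsAssocScheme A
  primIdem : IsPrimIdem A fun α : {a // a ∈ D} => E α.1
  eps_mem : ∀ i : Fin ℓ, epsV i ∈ D
  lower_closed : ∀ α ∈ D, ∀ β : Fin ℓ → ℕ, (∀ i, β i ≤ α i) → β ∈ D
  exists_poly : ∀ α ∈ D, ∃ v : MvPolynomial (Fin ℓ) ℂ,
    (Fintype.card X : ℂ) • E α
        = hEval v (fun i => (Fintype.card X : ℂ) • E (epsV i)) ∧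
      IsMultideg mo v α ∧ ∀ d ∈ v.support, ⇑d ∈ D
  recur : ∀ i : Fin ℓ, ∀ α ∈ D, ∃ c : (Fin ℓ → ℕ) → ℂ,
    (Matrix.hadamard (E (epsV i)) (hpow (fun j => E (epsV j)) α)
        = ∑ β ∈ D, c β • hpow (fun j => E (epsV j)) β) ∧
      ∀ β ∈ D, c β ≠ 0 → mo.le β (α + epsV i)

/-- The graded lexicographic order on `ℕ^ℓ`. -/
def grlexLe {ℓ : ℕ} (a b : Fin ℓ → ℕ) : Prop :=
  (∑ i, a i) < (∑ i, b i) ∨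
    ((∑ i, a i) = (∑ i, b i) ∧
      (a = b ∨ ∃ i, (∀ j, j < i → a j = b j) ∧ a i < b i))

/-- The lexicographic order on `ℕ^ℓ`. -/
def lexLe {ℓ : ℕ} (a b : Fin ℓ → ℕ) : Prop :=
  a = b ∨ ∃ i, (∀ j, j < i → a j = b j) ∧ a i < b i

/-- Evaluation of a univariate polynomial at a matrix under the Hadamard product. -/
def hEval1 {X : Type*} (v : Polynomial ℂ) (M : Matrix X X ℂ) : Matrix X X ℂ :=
  ∑ n ∈ v.support, v.coeff n • Matrix.of fun x y => (M x y) ^ n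

end

open scoped Classical

section PPolynomialCriterion

variable {X : Type*} {ℓ : ℕ}

lemma list_prod_map_pow_add_single {M : Type*} [Monoid M] {ι : Type*} [DecidableEq ι]
    (a : ι → M) (hcomm : ∀ i j, Commute (a i) (a j)) (α : ι → ℕ) (i : ι) (L : List ι)
    (hL : L.Nodup) (hi : i ∈ L) :
    (L.map fun j => a j ^ (α + Pi.single i 1 : ι → ℕ) j).prod = a i * (L.map fun j => a j ^ α j).prod := by
  induction L with
  | nil => simp at hi
  | cons k L ih =>
    obtain ⟨hk, hL⟩ := List.nodup_cons.mp hL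
    simp only [List.map_cons, List.prod_cons]
    by_cases hik : i = k
    · subst hik
      have : (L.map fun j => a j ^ (α + Pi.single i 1 : ι → ℕ) j) = L.map fun j => a j ^ α j := by
        refine List.map_congr_left fun j hj => ?_
        have : j ≠ i := fun h => hk (h ▸ hj)
        simp [this]
      rw [this]
      simp [pow_succ', mul_assoc]
    · have hki : k ≠ i := fun h => hik h.symm
      rw [ih hL ((List.mem_cons.mp hi).resolve_left hik)]
      simp only [Pi.add_apply, Pi.single_eq_of_ne hki, add_zero]
      rw [← mul_assoc, ← mul_assoc, ((hcomm k i).pow_left _).eq]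

/-- The span of the matrices `M β` with `β ∈ D` and `β < α`. -/
def spanLT (D : Finset (Fin ℓ → ℕ)) (mo : MonOrder ℓ) (M : (Fin ℓ → ℕ) → Matrix X X ℂ)
    (α : Fin ℓ → ℕ) : Submodule ℂ (Matrix X X ℂ) :=
  Submodule.span ℂ (M '' ↑(D.filter fun β => mo.le β α ∧ β ≠ α))

lemma MonOrder.lt_of_lt_of_le (mo : MonOrder ℓ) {a b c : Fin ℓ → ℕ} (hab : mo.le a b ∧ a ≠ b)
    (hbc : mo.le b c) : mo.le a c ∧ a ≠ c := by
  refine ⟨mo.le_trans _ _ _ hab.1 hbc, ?_⟩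
  rintro rfl
  exact hab.2 (mo.le_antisymm _ _ hab.1 hbc)

lemma MonOrder.lt_of_le_of_lt (mo : MonOrder ℓ) {a b c : Fin ℓ → ℕ} (hab : mo.le a b)
    (hbc : mo.le b c ∧ b ≠ c) : mo.le a c ∧ a ≠ c := by
  refine ⟨mo.le_trans _ _ _ hab hbc.1, ?_⟩
  rintro rfl
  exact hbc.2 (mo.le_antisymm _ _ hbc.1 hab)

lemma spanLT_mono {D : Finset (Fin ℓ → ℕ)} {mo : MonOrder ℓ} {M : (Fin ℓ → ℕ) → Matrix X X ℂ}
    {α β : Fin ℓ → ℕ} (h : mo.le α β) : spanLT D mo M α ≤ spanLT D mo M β := by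
  refine Submodule.span_mono (Set.image_mono fun γ hγ => ?_)
  simp only [Finset.coe_filter, Set.mem_ofPred_eq] at hγ ⊢
  exact ⟨hγ.1, mo.lt_of_lt_of_le hγ.2 h⟩

lemma mem_spanLT {D : Finset (Fin ℓ → ℕ)} {mo : MonOrder ℓ} {M : (Fin ℓ → ℕ) → Matrix X X ℂ}
    {α β : Fin ℓ → ℕ} (hβ : β ∈ D) (h : mo.le β α ∧ β ≠ α) : M β ∈ spanLT D mo M α :=
  Submodule.subset_span ⟨β, by simpa using ⟨hβ, h⟩, rfl⟩

/-- A family that is unitriangular, up to nonzero scalars, over another one: the second is then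
unitriangular over the first. -/
lemma triangular_inverse (D : Finset (Fin ℓ → ℕ)) (mo : MonOrder ℓ)
    (A B : (Fin ℓ → ℕ) → Matrix X X ℂ)
    (h : ∀ α ∈ D, ∃ c : ℂ, c ≠ 0 ∧ B α - c • A α ∈ spanLT D mo A α) :
    (∀ α, spanLT D mo A α ≤ spanLT D mo B α) ∧
      ∀ α ∈ D, ∃ c : ℂ, c ≠ 0 ∧ A α - c • B α ∈ spanLT D mo B α := by
  have key : ∀ α, spanLT D mo A α ≤ spanLT D mo B α := by
    intro α
    induction α using mo.wf.induction with
    | _ α ih =>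
      refine Submodule.span_le.mpr ?_
      rintro _ ⟨β, hβ, rfl⟩
      simp only [Finset.coe_filter, Set.mem_ofPred_eq] at hβ
      obtain ⟨c, hc, hs⟩ := h β hβ.1
      have h1 := spanLT_mono hβ.2.1 (ih β hβ.2 hs)
      have h2 : B β ∈ spanLT D mo B α := mem_spanLT hβ.1 hβ.2
      have h3 := Submodule.smul_mem _ c⁻¹ (Submodule.sub_mem _ h2 h1)
      rwa [sub_sub_cancel, inv_smul_smul₀ hc] at h3
  refine ⟨key, fun α hα => ?_⟩
  obtain ⟨c, hc, hs⟩ := h α hα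
  refine ⟨c⁻¹, inv_ne_zero hc, ?_⟩
  have h3 := Submodule.smul_mem _ (-c⁻¹) (key α hs)
  rw [smul_sub, smul_smul, neg_mul, inv_mul_cancel₀ hc, neg_smul, neg_smul, one_smul] at h3
  convert h3 using 1
  abel

lemma exists_coeff_of_mem_spanLT {D : Finset (Fin ℓ → ℕ)} {mo : MonOrder ℓ}
    {B : (Fin ℓ → ℕ) → Matrix X X ℂ} {α : Fin ℓ → ℕ} {Y : Matrix X X ℂ}
    (hY : Y ∈ spanLT D mo B α) :
    ∃ c : (Fin ℓ → ℕ) → ℂ, Y = ∑ β ∈ D, c β • B β ∧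
      ∀ β, c β ≠ 0 → β ∈ D ∧ mo.le β α ∧ β ≠ α := by
  obtain ⟨c, rfl⟩ := Submodule.mem_span_image_finset_iff_exists_fun' ℂ |>.mp hY
  refine ⟨fun β => if β ∈ D ∧ mo.le β α ∧ β ≠ α then c β else 0, ?_, ?_⟩
  · rw [Finset.sum_filter]
    refine Finset.sum_congr rfl fun β hβ => ?_
    simp only [hβ, true_and]
    split_ifs <;> simp
  · intro β hβ
    by_contra h
    simp [h] at hβ

variable [Fintype X] [DecidableEq X]

lemma mpow_zero (M : Fin ℓ → Matrix X X ℂ) : mpow M 0 = 1 := by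
  unfold mpow
  rw [List.prod_eq_one]
  simp

lemma mpow_add_epsV (M : Fin ℓ → Matrix X X ℂ) (hM : ∀ i j, Commute (M i) (M j))
    (α : Fin ℓ → ℕ) (i : Fin ℓ) : mpow M (α + epsV i) = M i * mpow M α :=
  list_prod_map_pow_add_single M hM α i _ (List.nodup_finRange ℓ) (List.mem_finRange i)

lemma matEval_sum_monomial (D : Finset (Fin ℓ → ℕ)) (c : (Fin ℓ → ℕ) → ℂ)
    (hc : ∀ β, c β ≠ 0 → β ∈ D) (M : Fin ℓ → Matrix X X ℂ) :
    ∃ v : MvPolynomial (Fin ℓ) ℂ, matEval v M = ∑ β ∈ D, c β • mpow M β ∧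
      ∀ d, v.coeff d = c ⇑d := by
  let v : MvPolynomial (Fin ℓ) ℂ := ∑ β ∈ D, MvPolynomial.monomial (toExp β) (c β)
  have hv : ∀ d, v.coeff d = c ⇑d := by
    intro d
    have hd : ∀ β, toExp β = d ↔ β = ⇑d := fun β => by
      rw [toExp, Equiv.symm_apply_eq]; rfl
    simp only [v, MvPolynomial.coeff_sum, MvPolynomial.coeff_monomial, hd]
    rw [Finset.sum_ite_eq']
    split_ifs with h
    · rfl
    · by_contra h'
      exact h (hc _ (Ne.symm h'))
  refine ⟨v, ?_, hv⟩
  unfold matEval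
  simp only [hv]
  refine Finset.sum_of_injOn (fun d => ⇑d) (fun _ _ _ _ h => DFunLike.coe_injective h) ?_ ?_ ?_
  · intro d hd
    exact hc _ (by simpa [MvPolynomial.mem_support_iff, hv] using hd)
  · intro β _ hβ
    by_contra h
    refine hβ ⟨toExp β, ?_, rfl⟩
    have : c β ≠ 0 := fun h' => h (by simp [h'])
    simpa [MvPolynomial.mem_support_iff, hv, toExp] using this
  · intros; rfl

/-- A sufficient condition for an association scheme to be multivariate `P`-polynomial: the
products `A_{ε_i} A_β` only involve `A_γ` with `γ ≤ β + ε_i`, and the top term occurs. -/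
theorem isMultiPPoly_of_mul_eq_lin {D : Finset (Fin ℓ → ℕ)} {mo : MonOrder ℓ}
    {A : (Fin ℓ → ℕ) → Matrix X X ℂ}
    (scheme : IsAssocScheme fun α : {a // a ∈ D} => A α.1)
    (eps_mem : ∀ i : Fin ℓ, epsV i ∈ D)
    (lower_closed : ∀ α ∈ D, ∀ β : Fin ℓ → ℕ, (∀ i, β i ≤ α i) → β ∈ D)
    (hzero : A 0 = 1)
    (hstep : ∀ i, ∀ β ∈ D, ∃ p : (Fin ℓ → ℕ) → ℂ,
      A (epsV i) * A β = ∑ γ ∈ D, p γ • A γ ∧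
      (∀ γ ∈ D, p γ ≠ 0 → mo.le γ (β + epsV i)) ∧ (β + epsV i ∈ D → p (β + epsV i) ≠ 0)) :
    IsMultiPPoly D mo A := by
  set M : Fin ℓ → Matrix X X ℂ := fun i => A (epsV i) with hMdef
  have hM : ∀ i j, Commute (M i) (M j) := fun i j =>
    scheme.mul_comm' ⟨_, eps_mem i⟩ ⟨_, eps_mem j⟩
  have hmul : ∀ i α (Y : Matrix X X ℂ), Y ∈ spanLT D mo A α →
      M i * Y ∈ spanLT D mo A (α + epsV i) := by
    intro i α Y hY
    induction hY using Submodule.span_induction with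
    | zero => simp
    | add x y _ _ hx hy => rw [mul_add]; exact add_mem hx hy
    | smul a x _ hx => rw [mul_smul_comm]; exact Submodule.smul_mem _ _ hx
    | mem x hx =>
      obtain ⟨β, hβ, rfl⟩ := hx
      simp only [Finset.coe_filter, Set.mem_ofPred_eq] at hβ
      obtain ⟨p, hp, hle, -⟩ := hstep i β hβ.1
      change A (epsV i) * A β ∈ _
      rw [hp]
      refine Submodule.sum_mem _ fun γ hγ => ?_
      by_cases h0 : p γ = 0
      · simp [h0]
      · refine Submodule.smul_mem _ _ (mem_spanLT hγ (mo.lt_of_le_of_lt (hle γ hγ h0)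
          ⟨mo.add_compat _ _ _ hβ.2.1, fun h => hβ.2.2 (add_right_cancel h)⟩))
  have hlead : ∀ N : ℕ, ∀ α ∈ D, ∑ i, α i = N →
      ∃ c : ℂ, c ≠ 0 ∧ mpow M α - c • A α ∈ spanLT D mo A α := by
    intro N
    induction N with
    | zero =>
      intro α _ hsum
      have : α = 0 := by
        ext i
        simpa using (Finset.sum_eq_zero_iff.mp hsum) i (Finset.mem_univ i)
      subst this
      exact ⟨1, one_ne_zero, by simp [mpow_zero, hzero]⟩
    | succ N ih =>
      intro α hα hsum
      obtain ⟨i, hi⟩ : ∃ i, α i ≠ 0 := by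
        by_contra! h
        simp [h] at hsum
      obtain ⟨β, rfl⟩ : ∃ β, α = β + epsV i := by
        refine ⟨α - epsV i, (tsub_add_cancel_of_le ?_).symm⟩
        intro j
        by_cases hj : j = i
        · subst hj; simpa [epsV] using Nat.one_le_iff_ne_zero.mpr hi
        · simp [epsV, hj]
      have hβ : β ∈ D := lower_closed _ hα _ fun j => by simp
      obtain ⟨c, hc, hs⟩ := ih β hβ (by simpa [epsV, Finset.sum_add_distrib] using hsum)
      obtain ⟨p, hp, hle, htop⟩ := hstep i β hβ
      refine ⟨c * p (β + epsV i), mul_ne_zero hc (htop hα), ?_⟩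
      have hrest : M i * A β - p (β + epsV i) • A (β + epsV i) ∈
          spanLT D mo A (β + epsV i) := by
        change A (epsV i) * A β - _ ∈ _
        rw [hp, ← Finset.add_sum_erase _ _ hα, add_sub_cancel_left]
        refine Submodule.sum_mem _ fun γ hγ => ?_
        obtain ⟨hne, hγ⟩ := Finset.mem_erase.mp hγ
        by_cases h0 : p γ = 0
        · simp [h0]
        · exact Submodule.smul_mem _ _ (mem_spanLT hγ ⟨hle γ hγ h0, hne⟩)
      have := add_mem (hmul i β _ hs) (Submodule.smul_mem _ c hrest)
      rw [mpow_add_epsV M hM]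
      convert this using 1
      rw [mul_sub, smul_sub, smul_smul, mul_smul_comm]
      abel
  have hlead' : ∀ α ∈ D, ∃ c : ℂ, c ≠ 0 ∧ mpow M α - c • A α ∈ spanLT D mo A α :=
    fun α hα => hlead _ α hα rfl
  obtain ⟨hspan, hinv⟩ := triangular_inverse D mo A (mpow M) hlead'
  have hexpand : ∀ α ∈ D, ∃ c : (Fin ℓ → ℕ) → ℂ, A α = ∑ β ∈ D, c β • mpow M β ∧
      c α ≠ 0 ∧ ∀ β, c β ≠ 0 → β ∈ D ∧ mo.le β α := by
    intro α hα
    obtain ⟨a, ha, hs⟩ := hinv α hα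
    obtain ⟨c, hc, hlt⟩ := exists_coeff_of_mem_spanLT hs
    have hcα : c α = 0 := by
      by_contra h
      exact (hlt α h).2.2 rfl
    refine ⟨c + Pi.single α a, ?_, by simpa [hcα] using ha, fun β hβ => ?_⟩
    · rw [sub_eq_iff_eq_add] at hc
      rw [hc]
      simp only [Pi.add_apply, add_smul, Finset.sum_add_distrib]
      congr 1
      rw [Finset.sum_eq_single_of_mem α hα fun β _ hβ => by simp [hβ]]
      simp
    · by_cases h : β = α
      · subst h; exact ⟨hα, mo.le_refl _⟩
      · have := hlt β (by simpa [h] using hβ)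
        exact ⟨this.1, this.2.1⟩
  refine ⟨scheme, eps_mem, lower_closed, fun α hα => ?_, fun i α hα => ?_⟩
  · obtain ⟨c, hc, htop, hle⟩ := hexpand α hα
    obtain ⟨v, hv, hcoeff⟩ := matEval_sum_monomial D c (fun β hβ => (hle β hβ).1) M
    refine ⟨v, hc.trans hv.symm, ⟨by simpa [hcoeff, toExp] using htop, fun d hd => ?_⟩,
      fun d hd => ?_⟩
    · exact (hle _ (by simpa [MvPolynomial.mem_support_iff, hcoeff] using hd)).2
    · exact (hle _ (by simpa [MvPolynomial.mem_support_iff, hcoeff] using hd)).1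
  · by_cases hα' : α + epsV i ∈ D
    · refine ⟨Pi.single (α + epsV i) 1, ?_, fun β _ hβ => ?_⟩
      · change M i * mpow M α = _
        rw [Finset.sum_eq_single_of_mem _ hα' fun β _ hβ => by simp [hβ]]
        rw [Pi.single_eq_same, one_smul, ← mpow_add_epsV M hM]
      · have : β = α + epsV i := by
          by_contra h
          simp [h] at hβ
        exact this ▸ mo.le_refl _
    · obtain ⟨a, ha, hs⟩ := hlead' α hα
      obtain ⟨p, hp, hle, -⟩ := hstep i α hα
      have hmem : M i * mpow M α ∈ spanLT D mo A (α + epsV i) := by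
        have h1 : M i * A α ∈ spanLT D mo A (α + epsV i) := by
          change A (epsV i) * A α ∈ _
          rw [hp]
          refine Submodule.sum_mem _ fun γ hγ => ?_
          by_cases h0 : p γ = 0
          · simp [h0]
          · exact Submodule.smul_mem _ _
              (mem_spanLT hγ ⟨hle γ hγ h0, fun h => hα' (h ▸ hγ)⟩)
        have := add_mem (hmul i α _ hs) (Submodule.smul_mem _ a h1)
        rwa [mul_sub, mul_smul_comm, sub_add_cancel] at this
      obtain ⟨c, hc, hlt⟩ := exists_coeff_of_mem_spanLT (hspan _ hmem)
      exact ⟨c, hc, fun β _ hβ => (hlt β hβ).2.1⟩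

end PPolynomialCriterion

section RelationScheme

variable {X : Type*} [Fintype X] {ℓ : ℕ} {D : Finset (Fin ℓ → ℕ)}
  {A : (Fin ℓ → ℕ) → Matrix X X ℂ} {rel : X → X → Fin ℓ → ℕ}

/-- If a group of permutations acts transitively on each relation, then products of adjacency
matrices expand with intersection numbers; the coefficients at empty relations are arbitrary. -/
lemma exists_intersection_numbers (hmem : ∀ x y, rel x y ∈ D)
    (htrans : ∀ x y x' y', rel x y = rel x' y' →
      ∃ g : X ≃ X, g x = x' ∧ g y = y' ∧ ∀ a b, rel (g a) (g b) = rel a b)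
    (hA : ∀ α ∈ D, ∀ x y, A α x y = if rel x y = α then 1 else 0)
    {α β : Fin ℓ → ℕ} (hα : α ∈ D) (hβ : β ∈ D) (c : (Fin ℓ → ℕ) → ℂ) :
    ∃ p : (Fin ℓ → ℕ) → ℂ, A α * A β = ∑ γ ∈ D, p γ • A γ ∧
      (∀ x z, p (rel x z) ≠ 0 ↔ ∃ y, rel x y = α ∧ rel y z = β) ∧
      ∀ γ, (∀ x z, rel x z ≠ γ) → p γ = c γ := by
  have hentry : ∀ x z, (A α * A β) x z =
      ((Finset.univ.filter fun y => rel x y = α ∧ rel y z = β).card : ℂ) := by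
    intro x z
    rw [Matrix.mul_apply, Finset.card_filter, Nat.cast_sum]
    refine Finset.sum_congr rfl fun y _ => ?_
    rw [hA α hα, hA β hβ]
    by_cases h1 : rel x y = α <;> by_cases h2 : rel y z = β <;> simp [h1, h2]
  have hconst : ∀ x z x' z', rel x z = rel x' z' → (A α * A β) x z = (A α * A β) x' z' := by
    intro x z x' z' h
    obtain ⟨g, rfl, rfl, hg⟩ := htrans x z x' z' h
    rw [hentry, hentry]
    congr 1
    refine Finset.card_equiv g fun y => ?_
    simp [hg]
  let p : (Fin ℓ → ℕ) → ℂ := fun γ =>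
    if h : ∃ xz : X × X, rel xz.1 xz.2 = γ then (A α * A β) h.choose.1 h.choose.2 else c γ
  have hp : ∀ x z, p (rel x z) = (A α * A β) x z := by
    intro x z
    have h : ∃ xz : X × X, rel xz.1 xz.2 = rel x z := ⟨(x, z), rfl⟩
    simp only [p, dif_pos h]
    exact hconst _ _ _ _ h.choose_spec
  refine ⟨p, ?_, fun x z => ?_, fun γ hγ => ?_⟩
  · ext x z
    rw [Matrix.sum_apply, Finset.sum_eq_single_of_mem (rel x z) (hmem x z)]
    · rw [Matrix.smul_apply, hA _ (hmem x z), if_pos rfl, hp]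
      simp
    · intro γ hγ hne
      rw [Matrix.smul_apply, hA γ hγ, if_neg hne.symm, smul_zero]
  · rw [hp, hentry, Nat.cast_ne_zero, Finset.card_ne_zero, Finset.filter_nonempty_iff]
    simp
  · have h : ¬ ∃ xz : X × X, rel xz.1 xz.2 = γ := fun ⟨xz, h⟩ => hγ _ _ h
    simp only [p, dif_neg h]

/-- A symmetric relation map whose relations are orbits of a group of permutations defines a
symmetric association scheme. -/
lemma isAssocScheme_of_rel [DecidableEq X] (hmem : ∀ x y, rel x y ∈ D) (hsymm : ∀ x y, rel x y = rel y x)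
    (hzero : ∀ x y, rel x y = 0 ↔ x = y) (hD : 0 ∈ D)
    (htrans : ∀ x y x' y', rel x y = rel x' y' →
      ∃ g : X ≃ X, g x = x' ∧ g y = y' ∧ ∀ a b, rel (g a) (g b) = rel a b)
    (hA : ∀ α ∈ D, ∀ x y, A α x y = if rel x y = α then 1 else 0) :
    IsAssocScheme fun α : {a // a ∈ D} => A α.1 := by
  have htranspose : ∀ α ∈ D, (A α)ᵀ = A α := by
    intro α hα
    ext x y
    rw [Matrix.transpose_apply, hA α hα, hA α hα, hsymm]
  have hprod : ∀ α ∈ D, ∀ β ∈ D, ∃ p : (Fin ℓ → ℕ) → ℂ, A α * A β = ∑ γ ∈ D, p γ • A γ :=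
    fun α hα β hβ =>
      (exists_intersection_numbers hmem htrans hA hα hβ 0).imp fun _ h => h.1
  refine ⟨?_, ?_, ⟨⟨0, hD⟩, ?_⟩, fun α => ⟨α, htranspose α.1 α.2⟩, ?_, ?_⟩
  · intro α x y
    rw [hA α.1 α.2]
    split_ifs <;> simp
  · ext x y
    rw [Finset.sum_coe_sort D A, Matrix.sum_apply,
      Finset.sum_eq_single_of_mem (rel x y) (hmem x y)]
    · rw [hA _ (hmem x y), if_pos rfl]
      rfl
    · intro γ hγ hne
      rw [hA γ hγ, if_neg hne.symm]
  · ext x y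
    rw [hA 0 hD, Matrix.one_apply]
    simp only [hzero]
  · intro α β
    obtain ⟨p, hp⟩ := hprod α.1 α.2 β.1 β.2
    exact ⟨fun γ => p γ.1, hp.trans (Finset.sum_coe_sort D fun γ => p γ • A γ).symm⟩
  · intro α β
    obtain ⟨p, hp⟩ := hprod α.1 α.2 β.1 β.2
    have h := congrArg Matrix.transpose hp
    rw [Matrix.transpose_mul, htranspose _ α.2, htranspose _ β.2] at h
    rw [hp, h, Matrix.transpose_sum]
    refine Finset.sum_congr rfl fun γ hγ => ?_
    rw [Matrix.transpose_smul, htranspose γ hγ]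

end RelationScheme

section SubspacePairs

open Module

variable {K E : Type*} [Field K] [AddCommGroup E] [Module K E]

lemma map_mkQ_inf_map_mkQ (W A B : Submodule K E) :
    A.map W.mkQ ⊓ B.map W.mkQ = (A ⊓ (W ⊔ B)).map W.mkQ := by
  rw [Submodule.map_inf_eq_map_inf_comap, Submodule.comap_map_mkQ]

lemma finrank_map_mkQ {W A : Submodule K E} (h : A ⊓ W = ⊥) :
    finrank K (A.map W.mkQ) = finrank K A := by
  have hinj : Function.Injective (W.mkQ ∘ₗ A.subtype) := by
    rw [← LinearMap.ker_eq_bot, LinearMap.ker_comp, Submodule.ker_mkQ]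
    rw [← Submodule.disjoint_iff_comap_eq_bot]
    exact disjoint_iff.mpr h
  rw [← LinearMap.finrank_range_of_inj hinj, LinearMap.range_comp, Submodule.range_subtype]

lemma finrank_map_mkQ_inf_map_mkQ {W A : Submodule K E} (h : A ⊓ W = ⊥) (B : Submodule K E) :
    finrank K ↥(A.map W.mkQ ⊓ B.map W.mkQ) = finrank K ↥(A ⊓ (W ⊔ B)) := by
  rw [map_mkQ_inf_map_mkQ, finrank_map_mkQ]
  rw [eq_bot_iff, ← h]
  exact inf_le_inf_right _ inf_le_left

variable [FiniteDimensional K E]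

lemma finrank_inf_add_finrank_inf_le (A B C : Submodule K E) :
    finrank K ↥(A ⊓ B) + finrank K ↥(B ⊓ C) ≤ finrank K B + finrank K ↥(A ⊓ C) := by
  rw [← Submodule.finrank_sup_add_finrank_inf_eq]
  exact add_le_add (Submodule.finrank_mono (sup_le inf_le_right inf_le_left))
    (Submodule.finrank_mono (inf_le_inf inf_le_left inf_le_right))

lemma finrank_inf_sup_le (W A B : Submodule K E) :
    finrank K ↥(A ⊓ (W ⊔ B)) ≤ finrank K ↥(A ⊓ B) + finrank K W := by
  have h1 := Submodule.finrank_sup_add_finrank_inf_eq (A ⊓ (W ⊔ B)) B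
  have h2 : finrank K ↥(A ⊓ (W ⊔ B) ⊔ B) ≤ finrank K ↥(W ⊔ B) :=
    Submodule.finrank_mono (sup_le inf_le_right le_sup_right)
  have h3 := Submodule.finrank_add_le_finrank_add_finrank W B
  have h4 : finrank K ↥(A ⊓ (W ⊔ B) ⊓ B) ≤ finrank K ↥(A ⊓ B) :=
    Submodule.finrank_mono (inf_le_inf_right _ inf_le_left)
  omega

lemma exists_sup_span_range_eq {A B : Submodule K E} (h : A ≤ B) {k : ℕ}
    (hk : finrank K B = finrank K A + k) :
    ∃ f : Fin k → E, A ⊔ Submodule.span K (Set.range f) = B := by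
  obtain ⟨C, hC⟩ := Submodule.exists_isCompl A
  have hsup : A ⊔ C ⊓ B = B := by
    rw [← sup_inf_assoc_of_le C h, hC.sup_eq_top, top_inf_eq]
  have hinf : A ⊓ (C ⊓ B) = ⊥ := by
    rw [← inf_assoc, hC.inf_eq_bot, bot_inf_eq]
  have hdim : finrank K ↥(C ⊓ B) = k := by
    have := Submodule.finrank_sup_add_finrank_inf_eq A (C ⊓ B)
    rw [hsup, hinf, finrank_bot] at this
    omega
  let b := finBasisOfFinrankEq K ↥(C ⊓ B) hdim
  refine ⟨fun t => b t, ?_⟩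
  have : Set.range (fun t => (b t : E)) = (C ⊓ B).subtype '' Set.range b := by
    rw [← Set.range_comp]; rfl
  rw [this, Submodule.span_image, b.span_eq, Submodule.map_top, Submodule.range_subtype, hsup]

lemma exists_hyperplane_avoiding {A V : Submodule K E} (hAV : A ≤ V) {x : E} (hxV : x ∈ V)
    (hxA : x ∉ A) :
    ∃ H : Submodule K E, A ≤ H ∧ x ∉ H ∧ H ⊔ Submodule.span K {x} = V ∧
      finrank K H + 1 = finrank K V := by
  obtain ⟨f, hfx, hf⟩ := Submodule.exists_le_ker_of_notMem hxA
  have hxH : x ∉ V ⊓ LinearMap.ker f := fun h => hfx h.2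
  have hsup : V ⊓ LinearMap.ker f ⊔ Submodule.span K {x} = V := by
    refine le_antisymm (sup_le inf_le_left (by simpa using hxV)) fun v hv => ?_
    rw [Submodule.mem_sup]
    refine ⟨v - (f v / f x) • x, ⟨sub_mem hv (Submodule.smul_mem _ _ hxV), ?_⟩,
      (f v / f x) • x, Submodule.smul_mem _ _ (Submodule.mem_span_singleton_self x), by simp⟩
    simp [hfx]
  refine ⟨V ⊓ LinearMap.ker f, le_inf hAV hf, hxH, hsup, ?_⟩
  rw [← Submodule.finrank_sup_span_singleton hxH, hsup]

/-- Adapted families for two subspaces both meeting `W` trivially. -/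
lemma exists_adapted_family {W A B : Submodule K E} (hA : A ⊓ W = ⊥) (hB : B ⊓ W = ⊥)
    {a i j k : ℕ} (hAB : finrank K ↥(A ⊓ B) = a) (hAWB : finrank K ↥(A ⊓ (W ⊔ B)) = a + j)
    (hBWA : finrank K ↥(B ⊓ (W ⊔ A)) = a + j) (hdA : finrank K A = a + j + i)
    (hdB : finrank K B = a + j + i) (hdW : finrank K W = j + k) :
    ∃ (u : Fin a → E) (p w : Fin j → E) (x : Fin k → E) (r s : Fin i → E),
      LinearIndependent K (Sum.elim u (Sum.elim p (Sum.elim w (Sum.elim x (Sum.elim r s))))) ∧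
      W = Submodule.span K (Set.range w ∪ Set.range x) ∧
      A = Submodule.span K (Set.range u ∪ Set.range p ∪ Set.range r) ∧
      B = Submodule.span K (Set.range u ∪ Set.range (p - w) ∪ Set.range s) := by
  set P := A ⊓ (W ⊔ B) with hP
  set Q := B ⊓ (W ⊔ A) with hQ
  have hUP : A ⊓ B ≤ P := le_inf inf_le_left (inf_le_right.trans le_sup_right)
  have hUQ : A ⊓ B ≤ Q := le_inf inf_le_right (inf_le_left.trans le_sup_right)
  have hPA : P ≤ A := inf_le_left
  have hQB : Q ≤ B := inf_le_left
  obtain ⟨u, hu⟩ := exists_sup_span_range_eq (bot_le (a := A ⊓ B)) (k := a) (by simpa using hAB)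
  rw [bot_sup_eq] at hu
  obtain ⟨p, hp⟩ := exists_sup_span_range_eq hUP (hAWB.trans (by rw [hAB]))
  obtain ⟨r, hr⟩ := exists_sup_span_range_eq hPA (hdA.trans (by rw [hAWB]))
  obtain ⟨s, hs⟩ := exists_sup_span_range_eq hQB (hdB.trans (by rw [hBWA]))
  have hpP : ∀ t, p t ∈ P := fun t =>
    hp ▸ Submodule.mem_sup_right (Submodule.subset_span ⟨t, rfl⟩)
  have hw : ∀ t, ∃ w ∈ W, p t - w ∈ B := fun t => by
    obtain ⟨w, hw, b, hb, h⟩ := Submodule.mem_sup.mp (hpP t).2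
    exact ⟨w, hw, by rwa [← h, add_sub_cancel_left]⟩
  choose w hwW hwB using hw
  have hspan_w : Submodule.span K (Set.range w) ≤ W :=
    Submodule.span_le.mpr (by rintro _ ⟨t, rfl⟩; exact hwW t)
  have hpw_le : A ⊓ B ⊔ Submodule.span K (Set.range (p - w)) ≤ Q := by
    refine sup_le hUQ (Submodule.span_le.mpr ?_)
    rintro _ ⟨t, rfl⟩
    refine ⟨hwB t, ?_⟩
    rw [Pi.sub_apply, sub_eq_neg_add]
    exact Submodule.add_mem_sup (neg_mem (hwW t)) (hpP t).1
  have hp_le : ∀ S : Submodule K E, Submodule.span K (Set.range w) ≤ S →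
      Submodule.span K (Set.range (p - w)) ≤ S → Submodule.span K (Set.range p) ≤ S := by
    intro S h1 h2
    refine Submodule.span_le.mpr ?_
    rintro _ ⟨t, rfl⟩
    have := add_mem (h2 (Submodule.subset_span ⟨t, rfl⟩)) (h1 (Submodule.subset_span ⟨t, rfl⟩))
    simpa using this
  have hpw : A ⊓ B ⊔ Submodule.span K (Set.range (p - w)) = Q := by
    refine le_antisymm hpw_le fun y hy => ?_
    obtain ⟨w₀, hw₀, v, hv, rfl⟩ := Submodule.mem_sup.mp hy.2
    have hvP : v ∈ P := ⟨hv, by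
      have := Submodule.add_mem_sup (neg_mem hw₀) hy.1
      simpa using this⟩
    have hPle : P ≤ (A ⊓ B ⊔ Submodule.span K (Set.range (p - w))) ⊔ W := by
      rw [← hp]
      exact sup_le (le_sup_left.trans le_sup_left)
        (hp_le _ (hspan_w.trans le_sup_right) (le_sup_right.trans le_sup_left))
    obtain ⟨z, hz, w₁, hw₁, rfl⟩ := Submodule.mem_sup.mp (hPle hvP)
    have h0 : w₀ + w₁ ∈ B ⊓ W := by
      refine ⟨?_, add_mem hw₀ hw₁⟩
      have := sub_mem hy.1 (hpw_le hz).1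
      rwa [show w₀ + (z + w₁) - z = w₀ + w₁ by abel] at this
    rw [hB, Submodule.mem_bot] at h0
    rwa [show w₀ + (z + w₁) = z + (w₀ + w₁) by abel, h0, add_zero]
  have hdw : finrank K (Submodule.span K (Set.range w)) = j := by
    refine le_antisymm ((finrank_range_le_card w).trans (by simp)) ?_
    have h1 := Submodule.finrank_sup_add_finrank_inf_eq P Q
    have h2 : finrank K ↥(P ⊓ Q) ≤ finrank K ↥(A ⊓ B) :=
      Submodule.finrank_mono (inf_le_inf inf_le_left inf_le_left)
    have h3 : P ⊔ Q ≤ P ⊔ Submodule.span K (Set.range w) := by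
      refine sup_le le_sup_left ?_
      rw [← hpw]
      refine sup_le (hUP.trans le_sup_left) (Submodule.span_le.mpr ?_)
      rintro _ ⟨t, rfl⟩
      exact sub_mem (Submodule.mem_sup_left (hpP t))
        (Submodule.mem_sup_right (Submodule.subset_span ⟨t, rfl⟩))
    have h4 := (Submodule.finrank_mono h3).trans
      (Submodule.finrank_add_le_finrank_add_finrank _ _)
    omega
  obtain ⟨x, hx⟩ := exists_sup_span_range_eq hspan_w (hdW.trans (by rw [hdw]))
  refine ⟨u, p, w, x, r, s, ?_, ?_, ?_, ?_⟩
  · rw [linearIndependent_iff_card_le_finrank_span]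
    have hAle : W ⊔ A ⊔ B ≤ Submodule.span K (Set.range
        (Sum.elim u (Sum.elim p (Sum.elim w (Sum.elim x (Sum.elim r s)))))) := by
      simp only [Set.Sum.elim_range]
      have hpw_le' : Submodule.span K (Set.range (p - w)) ≤
          Submodule.span K (Set.range p) ⊔ Submodule.span K (Set.range w) := by
        refine Submodule.span_le.mpr ?_
        rintro _ ⟨t, rfl⟩
        exact sub_mem (Submodule.mem_sup_left (Submodule.subset_span ⟨t, rfl⟩))
          (Submodule.mem_sup_right (Submodule.subset_span ⟨t, rfl⟩))
      refine sup_le (sup_le ?_ ?_) ?_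
      · rw [← hx]
        refine sup_le ?_ ?_ <;>
          exact Submodule.span_mono fun _ h => by simp only [Set.mem_union, h, true_or, or_true]
      · rw [← hr, ← hp, ← hu]
        refine sup_le (sup_le ?_ ?_) ?_ <;>
          exact Submodule.span_mono fun _ h => by simp only [Set.mem_union, h, true_or, or_true]
      · rw [← hs, ← hpw, ← hu]
        refine sup_le (sup_le ?_ (hpw_le'.trans (sup_le ?_ ?_))) ?_ <;>
          exact Submodule.span_mono fun _ h => by simp only [Set.mem_union, h, true_or, or_true]
    refine le_trans ?_ (Submodule.finrank_mono hAle)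
    have h1 := Submodule.finrank_sup_add_finrank_inf_eq W A
    have h2 := Submodule.finrank_sup_add_finrank_inf_eq (W ⊔ A) B
    rw [inf_comm, hA, finrank_bot] at h1
    rw [inf_comm (W ⊔ A), ← hQ] at h2
    simp only [Fintype.card_sum, Fintype.card_fin]
    omega
  · rw [Submodule.span_union, hx]
  · rw [Submodule.span_union, Submodule.span_union, hu, hp, hr]
  · rw [Submodule.span_union, Submodule.span_union, hu, hpw, hs]

lemma exists_linearEquiv_apply_eq {ι : Type*} {b b' : ι → E} (hb : LinearIndependent K b)
    (hb' : LinearIndependent K b') : ∃ g : E ≃ₗ[K] E, ∀ t, g (b t) = b' t := by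
  let f := (Basis.span hb).equiv (Basis.span hb') (Equiv.refl ι)
  obtain ⟨g, hg⟩ := Submodule.exists_linearEquiv_restrict_eq f
  refine ⟨g, fun t => ?_⟩
  have h := hg (Basis.span hb t)
  rw [Basis.equiv_apply, Basis.span_apply, Equiv.refl_apply, Basis.span_apply] at h
  exact h.symm

/-- The stabilizer of `W` in the general linear group acts transitively on each relation of the
attenuated space. -/
lemma exists_linearEquiv_map_eq {W A B A' B' : Submodule K E}
    (hA : A ⊓ W = ⊥) (hB : B ⊓ W = ⊥) (hA' : A' ⊓ W = ⊥) (hB' : B' ⊓ W = ⊥)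
    (hdAB : finrank K A = finrank K B) (hdA : finrank K A' = finrank K A)
    (hdB : finrank K B' = finrank K B)
    (h₁ : finrank K ↥(A' ⊓ B') = finrank K ↥(A ⊓ B))
    (h₂ : finrank K ↥(A'.map W.mkQ ⊓ B'.map W.mkQ) = finrank K ↥(A.map W.mkQ ⊓ B.map W.mkQ)) :
    ∃ g : E ≃ₗ[K] E, W.map g.toLinearMap = W ∧ A.map g.toLinearMap = A' ∧
      B.map g.toLinearMap = B' := by
  have hBA := finrank_map_mkQ_inf_map_mkQ hB A
  have hBA' := finrank_map_mkQ_inf_map_mkQ hB' A'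
  rw [inf_comm, finrank_map_mkQ_inf_map_mkQ hA] at hBA
  rw [inf_comm, finrank_map_mkQ_inf_map_mkQ hA'] at hBA'
  rw [finrank_map_mkQ_inf_map_mkQ hA, finrank_map_mkQ_inf_map_mkQ hA'] at h₂
  have hle₁ : finrank K ↥(A ⊓ B) ≤ finrank K ↥(A ⊓ (W ⊔ B)) :=
    Submodule.finrank_mono (inf_le_inf_left _ le_sup_right)
  have hle₂ : finrank K ↥(A ⊓ (W ⊔ B)) ≤ finrank K A := Submodule.finrank_mono inf_le_left
  have hle₃ := finrank_inf_sup_le W A B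
  obtain ⟨j, hj⟩ := Nat.exists_eq_add_of_le hle₁
  obtain ⟨i, hi⟩ := Nat.exists_eq_add_of_le hle₂
  obtain ⟨k, hk⟩ : ∃ k, finrank K W = j + k := Nat.exists_eq_add_of_le (by omega)
  obtain ⟨u, p, w, x, r, s, hli, eW, eA, eB⟩ := exists_adapted_family hA hB (i := i) rfl hj
    (by omega) (by omega) (by omega) hk
  obtain ⟨u', p', w', x', r', s', hli', eW', eA', eB'⟩ := exists_adapted_family hA' hB' (i := i)
    h₁ (by omega) (by omega) (by omega) (by omega) hk
  obtain ⟨g, hg⟩ := exists_linearEquiv_apply_eq hli hli'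
  simp only [Sum.forall, Sum.elim_inl, Sum.elim_inr] at hg
  obtain ⟨gu, gp, gw, gx, gr, gs⟩ := hg
  have himage : ∀ {c : ℕ} {f f' : Fin c → E}, (∀ t, g (f t) = f' t) →
      g '' Set.range f = Set.range f' := by
    intro c f f' h
    rw [← Set.range_comp]
    exact congrArg Set.range (funext h)
  have gpw : ∀ t, g ((p - w) t) = (p' - w') t := fun t => by simp [gp, gw]
  refine ⟨g, ?_, ?_, ?_⟩
  · conv_lhs => rw [eW]
    conv_rhs => rw [eW']
    simp [Submodule.map_span, himage gw, himage gx]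
  · rw [eA, eA']
    simp [Submodule.map_span, himage gu, himage gp, himage gr]
  · rw [eB, eB']
    simp only [Submodule.map_span, LinearEquiv.coe_coe, Set.image_union, himage gu, himage gpw,
      himage gs]

/-- A neighbour `C` of `A` at relation `(1, 0)` that is one step closer to `B`. -/
lemma exists_neighbour_one_zero {W A B : Submodule K E} (hA : A ⊓ W = ⊥) (hB : B ⊓ W = ⊥)
    (hAB : finrank K A = finrank K B)
    (hlt : finrank K ↥(A.map W.mkQ ⊓ B.map W.mkQ) < finrank K A) :
    ∃ C : Submodule K E, C ⊓ W = ⊥ ∧ finrank K C = finrank K A ∧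
      finrank K ↥(A.map W.mkQ ⊓ C.map W.mkQ) + 1 = finrank K A ∧
      finrank K ↥(A ⊓ C) + 1 = finrank K A ∧
      finrank K ↥(C.map W.mkQ ⊓ B.map W.mkQ) = finrank K ↥(A.map W.mkQ ⊓ B.map W.mkQ) + 1 ∧
      finrank K ↥(C ⊓ B) = finrank K ↥(A ⊓ B) + 1 := by
  have hρ := finrank_map_mkQ_inf_map_mkQ hA B
  have hρ' := finrank_map_mkQ_inf_map_mkQ hB A
  rw [inf_comm] at hρ'
  obtain ⟨x, hxA, hxP⟩ : ∃ x ∈ A, x ∉ A ⊓ (W ⊔ B) := by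
    by_contra! h
    have := Submodule.finrank_mono (show A ≤ A ⊓ (W ⊔ B) from h)
    omega
  obtain ⟨y, hyB, hyWA⟩ : ∃ y ∈ B, y ∉ W ⊔ A := by
    by_contra! h
    have := Submodule.finrank_mono (show B ≤ B ⊓ (W ⊔ A) from fun y hy => ⟨hy, h y hy⟩)
    omega
  obtain ⟨H, hPH, -, hHA, hdH⟩ := exists_hyperplane_avoiding inf_le_left hxA hxP
  have hHA : H ≤ A := le_sup_left.trans hHA.le
  have hyA : y ∉ A := fun h => hyWA (Submodule.mem_sup_right h)
  have hyC : y ∈ H ⊔ Submodule.span K {y} :=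
    Submodule.mem_sup_right (Submodule.mem_span_singleton_self y)
  have hCW : (H ⊔ Submodule.span K {y}) ⊓ W = ⊥ := by
    rw [eq_bot_iff]
    rintro c ⟨hc, hcW⟩
    obtain ⟨h, hh, z, hz, rfl⟩ := Submodule.mem_sup.mp hc
    obtain ⟨t, rfl⟩ := Submodule.mem_span_singleton.mp hz
    have ht : t = 0 := by
      by_contra ht
      refine hyWA ((Submodule.smul_mem_iff _ ht).mp ?_)
      have := Submodule.add_mem_sup hcW (neg_mem (hHA hh))
      simpa using this
    subst ht
    rw [zero_smul, add_zero] at hcW ⊢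
    rw [← hA]
    exact ⟨hHA hh, hcW⟩
  have hdC := Submodule.finrank_sup_span_singleton (K := K) fun h : y ∈ H => hyA (hHA h)
  have hCA := finrank_map_mkQ_inf_map_mkQ hCW A
  have hCB := finrank_map_mkQ_inf_map_mkQ hCW B
  have hmC := finrank_map_mkQ hCW
  set C := H ⊔ Submodule.span K {y} with hC
  have hHC : H ≤ C := le_sup_left
  have h1 : finrank K H ≤ finrank K ↥(A ⊓ C) := Submodule.finrank_mono (le_inf hHA hHC)
  have h2 : finrank K ↥(A ⊓ C) ≤ finrank K ↥(C ⊓ (W ⊔ A)) :=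
    Submodule.finrank_mono (le_inf inf_le_right (inf_le_left.trans le_sup_right))
  have h3 : finrank K ↥(C ⊓ (W ⊔ A)) < finrank K C := by
    refine Submodule.finrank_lt_finrank_of_lt (lt_of_le_of_ne inf_le_left fun h => ?_)
    rw [← h] at hyC
    exact hyWA hyC.2
  have h4 : finrank K ↥(A ⊓ B) + 1 ≤ finrank K ↥(C ⊓ B) := by
    rw [← Submodule.finrank_sup_span_singleton fun h : y ∈ A ⊓ B => hyA h.1]
    refine Submodule.finrank_mono (sup_le (le_inf ?_ inf_le_right) ?_)
    · exact (le_inf inf_le_left (inf_le_right.trans le_sup_right)).trans (hPH.trans hHC)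
    · simpa using ⟨hyC, hyB⟩
  have h5 : finrank K ↥(A ⊓ (W ⊔ B)) + 1 ≤ finrank K ↥(C ⊓ (W ⊔ B)) := by
    rw [← Submodule.finrank_sup_span_singleton fun h : y ∈ A ⊓ (W ⊔ B) => hyA h.1]
    refine Submodule.finrank_mono (sup_le (le_inf (hPH.trans hHC) inf_le_right) ?_)
    simpa using ⟨hyC, Submodule.mem_sup_right hyB⟩
  have h6 := finrank_inf_add_finrank_inf_le A C B
  have h7 := finrank_inf_add_finrank_inf_le (A.map W.mkQ) (C.map W.mkQ) (B.map W.mkQ)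
  rw [inf_comm] at hCA
  refine ⟨C, hCW, ?_, ?_, ?_, ?_, ?_⟩ <;> omega

/-- A neighbour `C` of `A` at relation `(0, 1)` that is one step closer to `B`. -/
lemma exists_neighbour_zero_one {W A B : Submodule K E} (hA : A ⊓ W = ⊥)
    (hlt : finrank K ↥(A ⊓ B) < finrank K ↥(A.map W.mkQ ⊓ B.map W.mkQ)) :
    ∃ C : Submodule K E, C ⊓ W = ⊥ ∧ finrank K C = finrank K A ∧
      C.map W.mkQ = A.map W.mkQ ∧ finrank K ↥(A ⊓ C) + 1 = finrank K A ∧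
      finrank K ↥(C ⊓ B) = finrank K ↥(A ⊓ B) + 1 := by
  rw [finrank_map_mkQ_inf_map_mkQ hA] at hlt
  obtain ⟨x, hxP, hxU⟩ : ∃ x ∈ A ⊓ (W ⊔ B), x ∉ A ⊓ B := by
    by_contra! h
    have := Submodule.finrank_mono (show A ⊓ (W ⊔ B) ≤ A ⊓ B from h)
    omega
  obtain ⟨w, hw, y, hy, rfl⟩ := Submodule.mem_sup.mp hxP.2
  obtain ⟨H, hUH, hxH, hsup, hdH⟩ := exists_hyperplane_avoiding inf_le_left hxP.1 hxU
  have hHA : H ≤ A := le_sup_left.trans hsup.le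
  have hyA : y ∉ A := fun h => by
    have hw0 : w ∈ A ⊓ W := ⟨by simpa using sub_mem hxP.1 h, hw⟩
    rw [hA, Submodule.mem_bot] at hw0
    subst hw0
    exact hxU ⟨hxP.1, by simpa using hy⟩
  have hyC : y ∈ H ⊔ Submodule.span K {y} :=
    Submodule.mem_sup_right (Submodule.mem_span_singleton_self y)
  have hCW : (H ⊔ Submodule.span K {y}) ⊓ W = ⊥ := by
    rw [eq_bot_iff]
    rintro c ⟨hc, hcW⟩
    obtain ⟨h, hh, z, hz, rfl⟩ := Submodule.mem_sup.mp hc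
    obtain ⟨t, rfl⟩ := Submodule.mem_span_singleton.mp hz
    have h0 : h + t • (w + y) ∈ A ⊓ W := by
      refine ⟨add_mem (hHA hh) (Submodule.smul_mem _ _ hxP.1), ?_⟩
      have := add_mem hcW (Submodule.smul_mem _ t hw)
      rwa [show h + t • y + t • w = h + t • (w + y) by rw [smul_add]; abel] at this
    rw [hA, Submodule.mem_bot] at h0
    have ht : t = 0 := by
      by_contra ht
      refine hxH ((Submodule.smul_mem_iff _ ht).mp ?_)
      rw [eq_neg_of_add_eq_zero_right h0]
      exact neg_mem hh
    subst ht
    simpa using h0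
  have hmap : (H ⊔ Submodule.span K {y}).map W.mkQ = A.map W.mkQ := by
    have : W.mkQ (w + y) = W.mkQ y := by
      simpa using hw
    rw [← hsup, Submodule.map_sup, Submodule.map_sup, Submodule.map_span, Submodule.map_span,
      Set.image_singleton, Set.image_singleton, this]
  have hdC := Submodule.finrank_sup_span_singleton (K := K) fun h : y ∈ H => hyA (hHA h)
  set C := H ⊔ Submodule.span K {y} with hC
  have hHC : H ≤ C := le_sup_left
  have h1 : finrank K H ≤ finrank K ↥(A ⊓ C) := Submodule.finrank_mono (le_inf hHA hHC)
  have h3 : finrank K ↥(A ⊓ C) < finrank K C := by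
    refine Submodule.finrank_lt_finrank_of_lt (lt_of_le_of_ne inf_le_right fun h => ?_)
    rw [← h] at hyC
    exact hyA hyC.1
  have h4 : finrank K ↥(A ⊓ B) + 1 ≤ finrank K ↥(C ⊓ B) := by
    rw [← Submodule.finrank_sup_span_singleton fun h : y ∈ A ⊓ B => hyA h.1]
    refine Submodule.finrank_mono (sup_le (le_inf (hUH.trans hHC) inf_le_right) ?_)
    simpa using ⟨hyC, hy⟩
  have h6 := finrank_inf_add_finrank_inf_le A C B
  refine ⟨C, hCW, ?_, hmap, ?_, ?_⟩ <;> omega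

end SubspacePairs

section Attenuated

variable (F : Type*) [Field F] [Fintype F] (n l m : ℕ)
variable (W : Submodule F (Fin (n + l) → F))

/-- The set of `m`-dimensional subspaces of the attenuated space associated with
`𝔽_q^{n+l}` and the `l`-dimensional subspace `W`: the `m`-dimensional subspaces of
`𝔽_q^{n+l}` intersecting `W` trivially. -/
def AttX : Type _ :=
  {V : Submodule F (Fin (n + l) → F) // Module.finrank F V = m ∧ V ⊓ W = ⊥}

instance : Finite (Submodule F (Fin (n + l) → F)) :=
  Finite.of_injective (fun S => (S : Set (Fin (n + l) → F))) SetLike.coe_injective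

instance : Finite (AttX F n l m W) := by unfold AttX; exact Subtype.finite

noncomputable instance : Fintype (AttX F n l m W) := Fintype.ofFinite _

noncomputable instance : DecidableEq (AttX F n l m W) := Classical.decEq _

/-- The adjacency matrices of the association scheme obtained from the attenuated space:
`(V, V')` are in relation `(i, j)` iff `dim(V/W ∩ V'/W) = m - i` and
`dim(V ∩ V') = (m - i) - j`, where `V/W` stands for `(V + W)/W`. -/
noncomputable def attA : (Fin 2 → ℕ) → Matrix (AttX F n l m W) (AttX F n l m W) ℂ :=
  fun α => Matrix.of fun V V' =>
    if Module.finrank F ↥(Submodule.map W.mkQ V.1 ⊓ Submodule.map W.mkQ V'.1) = m - α 0 ∧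
        Module.finrank F ↥(V.1 ⊓ V'.1) = (m - α 0) - α 1
    then 1 else 0

/-- The domain `D = {(i,j) : 0 ≤ i ≤ min{m, n-m}, 0 ≤ j ≤ min{m-i, l}}`. -/
def attD : Finset (Fin 2 → ℕ) :=
  (Fintype.piFinset fun _ : Fin 2 => Finset.range (m + 1)).filter fun α =>
    α 0 ≤ min m (n - m) ∧ α 1 ≤ min (m - α 0) l

section

open Module

lemma grlexLe_of_le {a b : Fin 2 → ℕ} (hsum : a 0 + a 1 ≤ b 0 + b 1) (h0 : a 0 ≤ b 0) :
    grlexLe a b := by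
  unfold grlexLe
  simp only [Fin.sum_univ_two]
  rcases hsum.lt_or_eq with h | h
  · exact Or.inl h
  refine Or.inr ⟨h, ?_⟩
  rcases h0.lt_or_eq with h0 | h0
  · exact Or.inr ⟨0, fun j hj => absurd hj (Fin.not_lt_zero j), h0⟩
  · left
    ext t
    fin_cases t
    · exact h0
    · change a 1 = b 1
      omega

variable {F : Type*} [Field F] {n l m : ℕ} {W : Submodule F (Fin (n + l) → F)}

/-- The dimension of `V/W ∩ V'/W`. -/
noncomputable def attQuotDim (V V' : AttX F n l m W) : ℕ :=
  finrank F ↥(V.1.map W.mkQ ⊓ V'.1.map W.mkQ)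

/-- The dimension of `V ∩ V'`. -/
noncomputable def attDim (V V' : AttX F n l m W) : ℕ := finrank F ↥(V.1 ⊓ V'.1)

/-- The relation between two vertices of the attenuated space. -/
noncomputable def attRel (V V' : AttX F n l m W) : Fin 2 → ℕ :=
  ![m - attQuotDim V V', attQuotDim V V' - attDim V V']

lemma attQuotDim_eq (V V' : AttX F n l m W) :
    attQuotDim V V' = finrank F ↥(V.1 ⊓ (W ⊔ V'.1)) :=
  finrank_map_mkQ_inf_map_mkQ V.2.2 V'.1

lemma attQuotDim_comm (V V' : AttX F n l m W) : attQuotDim V V' = attQuotDim V' V := by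
  unfold attQuotDim
  rw [inf_comm]

lemma attDim_comm (V V' : AttX F n l m W) : attDim V V' = attDim V' V := by
  unfold attDim
  rw [inf_comm]

lemma attRel_comm (V V' : AttX F n l m W) : attRel V V' = attRel V' V := by
  unfold attRel
  rw [attQuotDim_comm, attDim_comm]

lemma attDim_le (V V' : AttX F n l m W) : attDim V V' ≤ attQuotDim V V' := by
  rw [attQuotDim_eq]
  exact Submodule.finrank_mono (inf_le_inf_left _ le_sup_right)

lemma attQuotDim_le (V V' : AttX F n l m W) : attQuotDim V V' ≤ m := by
  rw [attQuotDim_eq]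
  exact (Submodule.finrank_mono inf_le_left).trans V.2.1.le

lemma attQuotDim_le_add (hW : finrank F W = l) (V V' : AttX F n l m W) :
    attQuotDim V V' ≤ attDim V V' + l := by
  rw [attQuotDim_eq]
  exact (finrank_inf_sup_le _ _ _).trans_eq (by rw [hW, attDim])

lemma two_mul_le_attQuotDim_add (hW : finrank F W = l) (V V' : AttX F n l m W) :
    2 * m ≤ attQuotDim V V' + n := by
  have h1 := Submodule.finrank_sup_add_finrank_inf_eq (V.1.map W.mkQ) (V'.1.map W.mkQ)
  rw [finrank_map_mkQ V.2.2, finrank_map_mkQ V'.2.2, V.2.1, V'.2.1] at h1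
  have h2 := Submodule.finrank_le (V.1.map W.mkQ ⊔ V'.1.map W.mkQ)
  have h3 := W.finrank_quotient_add_finrank
  rw [hW, finrank_fin_fun] at h3
  change _ + attQuotDim V V' = _ at h1
  omega

lemma attDim_triangle (U V V' : AttX F n l m W) :
    attDim U V + attDim V V' ≤ m + attDim U V' :=
  (finrank_inf_add_finrank_inf_le U.1 V.1 V'.1).trans_eq (by rw [V.2.1, attDim])

lemma attQuotDim_triangle (U V V' : AttX F n l m W) :
    attQuotDim U V + attQuotDim V V' ≤ m + attQuotDim U V' :=
  (finrank_inf_add_finrank_inf_le (U.1.map W.mkQ) (V.1.map W.mkQ) (V'.1.map W.mkQ)).trans_eq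
    (by rw [finrank_map_mkQ V.2.2, V.2.1, attQuotDim])

lemma mem_attD_iff {α : Fin 2 → ℕ} :
    α ∈ attD n l m ↔ α 0 ≤ m ∧ α 0 ≤ n - m ∧ α 0 + α 1 ≤ m ∧ α 1 ≤ l := by
  simp only [attD, Finset.mem_filter, Fintype.mem_piFinset, Fin.forall_fin_two, Finset.mem_range,
    le_min_iff]
  omega

lemma attRel_eq_iff {V V' : AttX F n l m W} {α : Fin 2 → ℕ} (_hα : α 0 + α 1 ≤ m) :
    attRel V V' = α ↔ attQuotDim V V' + α 0 = m ∧ attDim V V' + α 0 + α 1 = m := by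
  have h1 := attQuotDim_le V V'
  have h2 := attDim_le V V'
  rw [funext_iff, Fin.forall_fin_two]
  change m - _ = _ ∧ attQuotDim V V' - _ = _ ↔ _
  omega

lemma attRel_mem (hW : finrank F W = l) (V V' : AttX F n l m W) :
    attRel V V' ∈ attD n l m := by
  have h1 := attQuotDim_le V V'
  have h2 := attDim_le V V'
  have h3 := attQuotDim_le_add hW V V'
  have h4 := two_mul_le_attQuotDim_add hW V V'
  rw [mem_attD_iff]
  change m - _ ≤ m ∧ m - _ ≤ n - m ∧ m - _ + (attQuotDim V V' - _) ≤ m ∧ attQuotDim V V' - _ ≤ l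
  omega

lemma attA_apply {α : Fin 2 → ℕ} (hα : α ∈ attD n l m) (V V' : AttX F n l m W) :
    attA F n l m W α V V' = if attRel V V' = α then 1 else 0 := by
  rw [mem_attD_iff] at hα
  refine if_congr ?_ rfl rfl
  rw [attRel_eq_iff hα.2.2.1]
  change attQuotDim V V' = _ ∧ attDim V V' = _ ↔ _
  omega

lemma attRel_eq_zero_iff (V V' : AttX F n l m W) : attRel V V' = 0 ↔ V = V' := by
  rw [attRel_eq_iff (by simp)]
  simp only [Pi.zero_apply, add_zero]
  constructor
  · rintro ⟨-, h⟩
    refine Subtype.ext ?_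
    rw [← Submodule.eq_of_le_of_finrank_eq (inf_le_left : V.1 ⊓ V'.1 ≤ V.1) (h.trans V.2.1.symm)]
    exact Submodule.eq_of_le_of_finrank_eq inf_le_right (h.trans V'.2.1.symm)
  · rintro rfl
    rw [attQuotDim, attDim, inf_idem, inf_idem, finrank_map_mkQ V.2.2]
    exact ⟨V.2.1, V.2.1⟩

lemma attRel_trans [Fintype F] (U V U' V' : AttX F n l m W) (h : attRel U V = attRel U' V') :
    ∃ g : AttX F n l m W ≃ AttX F n l m W, g U = U' ∧ g V = V' ∧
      ∀ a b, attRel (g a) (g b) = attRel a b := by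
  have h0 : m - attQuotDim U V = m - attQuotDim U' V' := congrFun h 0
  have h1 : attQuotDim U V - attDim U V = attQuotDim U' V' - attDim U' V' := congrFun h 1
  have hq : attQuotDim U' V' = attQuotDim U V := by
    have := attQuotDim_le U V
    have := attQuotDim_le U' V'
    omega
  have hd : attDim U' V' = attDim U V := by
    have := attDim_le U V
    have := attDim_le U' V'
    omega
  obtain ⟨e, heW, heU, heV⟩ := exists_linearEquiv_map_eq U.2.2 V.2.2 U'.2.2 V'.2.2
    (U.2.1.trans V.2.1.symm) (U'.2.1.trans U.2.1.symm) (V'.2.1.trans V.2.1.symm) hd hq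
  have hinj : Function.Injective e.toLinearMap := e.injective
  have hdisj (S : Submodule F (Fin (n + l) → F)) (hS : S ⊓ W = ⊥) :
      S.map e.toLinearMap ⊓ W = ⊥ := by
    conv_lhs => rw [← heW]
    rw [← Submodule.map_inf _ hinj, hS, Submodule.map_bot]
  have hsup (S T : Submodule F (Fin (n + l) → F)) :
      finrank F ↥(S.map e.toLinearMap ⊓ (W ⊔ T.map e.toLinearMap)) =
        finrank F ↥(S ⊓ (W ⊔ T)) := by
    conv_lhs => rw [← heW]
    rw [← Submodule.map_sup, ← Submodule.map_inf _ hinj]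
    exact LinearEquiv.finrank_map_eq e _
  let f : AttX F n l m W → AttX F n l m W := fun V =>
    ⟨V.1.map e.toLinearMap, (LinearEquiv.finrank_map_eq e V.1).trans V.2.1, hdisj V.1 V.2.2⟩
  have hf : Function.Injective f := fun A B hAB =>
    Subtype.ext (Submodule.map_injective_of_injective hinj (congrArg Subtype.val hAB))
  refine ⟨Equiv.ofBijective f (Finite.injective_iff_bijective.mp hf), Subtype.ext heU,
    Subtype.ext heV, fun A B => ?_⟩
  have hdim : attDim (f A) (f B) = attDim A B := by
    change finrank F ↥(A.1.map e.toLinearMap ⊓ B.1.map e.toLinearMap) = _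
    rw [← Submodule.map_inf _ hinj]
    exact LinearEquiv.finrank_map_eq e _
  have hquot : attQuotDim (f A) (f B) = attQuotDim A B := by
    rw [attQuotDim_eq, attQuotDim_eq]
    exact hsup A.1 B.1
  change attRel (f A) (f B) = _
  rw [attRel, attRel, hdim, hquot]

lemma attRel_eq_epsV_zero_iff (hm : 1 ≤ m) {V V' : AttX F n l m W} :
    attRel V V' = epsV 0 ↔ attQuotDim V V' + 1 = m ∧ attDim V V' + 1 = m := by
  rw [attRel_eq_iff] <;> simp [epsV, hm]

lemma attRel_eq_epsV_one_iff (hm : 1 ≤ m) {V V' : AttX F n l m W} :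
    attRel V V' = epsV 1 ↔ attQuotDim V V' = m ∧ attDim V V' + 1 = m := by
  rw [attRel_eq_iff] <;> simp [epsV, hm]

lemma attRel_le_of_neighbour (hm : 1 ≤ m) (i : Fin 2) {U V V' : AttX F n l m W}
    (h : attRel U V = epsV i) : grlexLe (attRel U V') (attRel V V' + epsV i) := by
  have h1 := attDim_triangle U V V'
  have h2 := attQuotDim_triangle U V V'
  have h3 := attDim_le U V'
  have h4 := attQuotDim_le U V'
  have h5 := attDim_le V V'
  have h6 := attQuotDim_le V V'
  fin_cases i
  · obtain ⟨hq, hd⟩ := (attRel_eq_epsV_zero_iff hm).mp h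
    refine grlexLe_of_le ?_ ?_
    · change m - attQuotDim U V' + (attQuotDim U V' - attDim U V') ≤
        m - attQuotDim V V' + 1 + (attQuotDim V V' - attDim V V' + 0)
      omega
    · change m - attQuotDim U V' ≤ m - attQuotDim V V' + 1
      omega
  · obtain ⟨hq, hd⟩ := (attRel_eq_epsV_one_iff hm).mp h
    refine grlexLe_of_le ?_ ?_
    · change m - attQuotDim U V' + (attQuotDim U V' - attDim U V') ≤
        m - attQuotDim V V' + 0 + (attQuotDim V V' - attDim V V' + 1)
      omega
    · change m - attQuotDim U V' ≤ m - attQuotDim V V' + 0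
      omega

lemma exists_neighbour_of_attRel_eq_add (hm : 1 ≤ m) (i : Fin 2) {β : Fin 2 → ℕ}
    (hβ : β + epsV i ∈ attD n l m) {U V : AttX F n l m W} (h : attRel U V = β + epsV i) :
    ∃ C : AttX F n l m W, attRel U C = epsV i ∧ attRel C V = β := by
  have hsum := (mem_attD_iff.mp hβ).2.2.1
  obtain ⟨hq, hd⟩ := (attRel_eq_iff hsum).mp h
  have hdU := U.2.1
  fin_cases i
  · change attQuotDim U V + (β 0 + 1) = m at hq
    change attDim U V + (β 0 + 1) + (β 1 + 0) = m at hd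
    obtain ⟨C, hCW, hdC, h1, h2, h3, h4⟩ := exists_neighbour_one_zero U.2.2 V.2.2
      (U.2.1.trans V.2.1.symm) (by change attQuotDim U V < _; omega)
    refine ⟨⟨C, hdC.trans hdU, hCW⟩, (attRel_eq_epsV_zero_iff hm).mpr
      ⟨h1.trans hdU, h2.trans hdU⟩, (attRel_eq_iff (by omega)).mpr ?_⟩
    change _ = attQuotDim U V + 1 at h3
    change _ = attDim U V + 1 at h4
    change finrank F ↥(C.map W.mkQ ⊓ V.1.map W.mkQ) + β 0 = m ∧
      finrank F ↥(C ⊓ V.1) + β 0 + β 1 = m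
    omega
  · change attQuotDim U V + (β 0 + 0) = m at hq
    change attDim U V + (β 0 + 0) + (β 1 + 1) = m at hd
    obtain ⟨C, hCW, hdC, h1, h2, h4⟩ := exists_neighbour_zero_one (B := V.1) U.2.2
      (by change attDim U V < attQuotDim U V; omega)
    refine ⟨⟨C, hdC.trans hdU, hCW⟩, (attRel_eq_epsV_one_iff hm).mpr
      ⟨?_, h2.trans hdU⟩, (attRel_eq_iff (by omega)).mpr ?_⟩
    · change finrank F ↥(U.1.map W.mkQ ⊓ C.map W.mkQ) = m
      rw [h1, inf_idem, finrank_map_mkQ U.2.2, hdU]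
    · change _ = attDim U V + 1 at h4
      change finrank F ↥(C.map W.mkQ ⊓ V.1.map W.mkQ) + β 0 = m ∧
        finrank F ↥(C ⊓ V.1) + β 0 + β 1 = m
      have h3 : finrank F ↥(C.map W.mkQ ⊓ V.1.map W.mkQ) = attQuotDim U V := by
        rw [h1, attQuotDim]
      omega

end

/-- Theorem 3.1: the association scheme obtained from an attenuated space is a bivariate
`P`-polynomial association scheme on `D` with respect to the graded lexicographic order,
for all parameters (including the case `l < m`). -/
theorem attenuated_isMultiPPoly (hm : 1 ≤ m) (hmn : m < n) (hl : 1 ≤ l)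
    (hW : Module.finrank F W = l)
    (mo : MonOrder 2) (hmo : mo.le = fun a b => grlexLe a b) :
    IsMultiPPoly (attD n l m) mo (attA F n l m W) := by
  have hmem : ∀ V V' : AttX F n l m W, attRel V V' ∈ attD n l m := attRel_mem hW
  have hA : ∀ α ∈ attD n l m, ∀ V V', attA F n l m W α V V' = if attRel V V' = α then 1 else 0 :=
    fun α hα => attA_apply hα
  have h0 : (0 : Fin 2 → ℕ) ∈ attD n l m := by simp [mem_attD_iff]
  have heps : ∀ i : Fin 2, epsV i ∈ attD n l m := by
    rw [Fin.forall_fin_two, mem_attD_iff, mem_attD_iff]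
    simp only [epsV, Pi.single_eq_same, ne_eq, one_ne_zero, zero_ne_one, not_false_eq_true,
      Pi.single_eq_of_ne]
    omega
  refine isMultiPPoly_of_mul_eq_lin
    (isAssocScheme_of_rel hmem attRel_comm attRel_eq_zero_iff h0 attRel_trans hA) heps ?_ ?_ ?_
  · intro α hα β hβ
    rw [mem_attD_iff] at hα ⊢
    have := hβ 0
    have := hβ 1
    omega
  · ext V V'
    rw [hA 0 h0, Matrix.one_apply]
    simp only [attRel_eq_zero_iff]
  · intro i β hβ
    obtain ⟨p, hp, hne, hempty⟩ := exists_intersection_numbers hmem attRel_trans hA (heps i) hβ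
      (Pi.single (β + epsV i) 1)
    refine ⟨p, hp, fun γ _ hpγ => ?_, fun hβ' => ?_⟩
    · rw [hmo]
      by_cases h : ∃ V V' : AttX F n l m W, attRel V V' = γ
      · obtain ⟨U, V', rfl⟩ := h
        obtain ⟨V, hUV, rfl⟩ := (hne U V').mp hpγ
        exact attRel_le_of_neighbour hm i hUV
      · push Not at h
        rw [hempty γ h] at hpγ
        obtain rfl : γ = β + epsV i := by
          by_contra h'
          exact hpγ (Pi.single_eq_of_ne h' _)
        exact grlexLe_of_le le_rfl le_rfl
    · by_cases h : ∃ V V' : AttX F n l m W, attRel V V' = β + epsV i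
      · obtain ⟨U, V', h⟩ := h
        rw [← h, hne]
        exact exists_neighbour_of_attRel_eq_add hm i hβ' h
      · push Not at h
        rw [hempty _ h, Pi.single_eq_same]
        exact one_ne_zero

end Attenuated
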